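/- Let f be a homeomorphism of a compact metric space M, let 𝒜 and ℬ be continuous GL(N,ℝ)-valued cocycles over f, and let μ be an ergodic f-invariant Borel probability measure. Suppose 𝒞: M → GL(N,ℝ) is a μ-measurable conjugacy taking 𝒜 to ℬ, i.e. ℬ_x = 𝒞(fx) 𝒜_x 𝒞(x)^{-1} for μ-a.e. x, and suppose that for μ-a.e. x the forward and backward Lyapunov exponents lim_{n→±∞} (1/n) ln‖𝒜^n_x u‖ and lim_{n→±∞} (1/n) ln‖ℬ^n_x v‖ exist for every nonzero u, v ∈ ℝ^N. Then for μ-a.e. x and for each nonzero vector u ∈ ℝ^N, the forward (respectively backward) Lyapunov exponent of u under 𝒜 at x equals the forward (respectively backward) Lyapunov exponent of 𝒞_x(u) under ℬ at x. -/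

import Mathlib

/-!
# Statement 9: Measurable conjugacies preserve Lyapunov exponents (Lemma 4.4)

Let `f` be a homeomorphism of a compact metric space `M`, `𝒜`, `ℬ` continuous
`GL(N,ℝ)`-valued cocycles over `f`, `μ` an ergodic `f`-invariant Borel
probability measure, and `𝒞` a `μ`-measurable conjugacy taking `𝒜` to `ℬ`.
If forward and backward Lyapunov exponents exist a.e. for all nonzero vectors,
then for a.e. `x` and every `u ≠ 0` the exponents of `u` under `𝒜` coincide
with those of `𝒞ₓ u` under `ℬ`.
-/

noncomputable section

open MeasureTheory Filter Topology

abbrev Euc (N : ℕ) := EuclideanSpace ℝ (Fin N)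

/-- Forward iterates of a linear cocycle: `coc f B n x = B(f^{n-1}x) ∘ ⋯ ∘ B(x)`. -/
def coc {M : Type*} {N : ℕ} (f : M → M) (B : M → (Euc N →L[ℝ] Euc N)) :
    ℕ → M → (Euc N →L[ℝ] Euc N)
  | 0, _ => 1
  | n + 1, x => (B (f^[n] x)).comp (coc f B n x)

/-- Backward iterates `𝒜^{-n}_x = (𝒜^n_{f^{-n}x})^{-1}`, written using the inverse
generator `B'` and the inverse map `finv`. -/
def cocNeg {M : Type*} {N : ℕ} (finv : M → M) (B' : M → (Euc N →L[ℝ] Euc N)) :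
    ℕ → M → (Euc N →L[ℝ] Euc N)
  | 0, _ => 1
  | n + 1, x => (cocNeg finv B' n (finv x)).comp (B' (finv x))

/-- `u` has forward Lyapunov exponent `c` at `x` under the cocycle generated by `B`. -/
def FwdExp {M : Type*} {N : ℕ} (f : M → M) (B : M → (Euc N →L[ℝ] Euc N))
    (x : M) (u : Euc N) (c : ℝ) : Prop :=
  Tendsto (fun n : ℕ => Real.log ‖coc f B n x u‖ / n) atTop (𝓝 c)

/-- `u` has backward Lyapunov exponent `c` at `x` (the limit of `(1/n) ln‖𝒜ⁿₓu‖` as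
`n → -∞`, i.e. of `-(1/n) ln‖𝒜⁻ⁿₓ u‖` as `n → ∞`). -/
def BwdExp {M : Type*} {N : ℕ} (finv : M → M) (B' : M → (Euc N →L[ℝ] Euc N))
    (x : M) (u : Euc N) (c : ℝ) : Prop :=
  Tendsto (fun n : ℕ => -(Real.log ‖cocNeg finv B' n x u‖ / n)) atTop (𝓝 c)

/-- If `‖b n‖ ≤ K ‖a n‖` for infinitely many `n`, the exponential growth rate of `b` is at most
that of `a`. -/
theorem growthRate_le_of_frequently {E : Type*} [NormedAddCommGroup E] {a b : ℕ → E} {c d K : ℝ}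
    (ha0 : ∀ n, a n ≠ 0) (hb0 : ∀ n, b n ≠ 0)
    (ha : Tendsto (fun n : ℕ => Real.log ‖a n‖ / n) atTop (𝓝 c))
    (hb : Tendsto (fun n : ℕ => Real.log ‖b n‖ / n) atTop (𝓝 d))
    (h : ∃ᶠ n in atTop, ‖b n‖ ≤ K * ‖a n‖) : d ≤ c := by
  have hlim : Tendsto (fun n : ℕ => Real.log K / n + Real.log ‖a n‖ / n) atTop (𝓝 c) := by
    simpa using (tendsto_const_div_atTop_nhds_zero_nat (Real.log K)).add ha
  refine le_of_tendsto_of_tendsto_of_frequently hb hlim (h.mono fun n hn => ?_)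
  have hpa : 0 < ‖a n‖ := norm_pos_iff.2 (ha0 n)
  have hpb : 0 < ‖b n‖ := norm_pos_iff.2 (hb0 n)
  have hK : 0 < K := pos_of_mul_pos_left (hpb.trans_le hn) hpa.le
  rw [← add_div, ← Real.log_mul hK.ne' hpa.ne']
  gcongr

/-- Two sequences intertwined by linear maps that are infinitely often bounded, together with
their left inverses, have the same exponential growth rate. -/
theorem growthRate_eq_of_intertwined {E : Type*} [NormedAddCommGroup E] [NormedSpace ℝ E]
    {a b : ℕ → E} {L L' : ℕ → E →L[ℝ] E} {c d K : ℝ} (ha0 : ∀ n, a n ≠ 0)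
    (hL : ∀ n, (L' n).comp (L n) = 1) (hab : ∀ n, b n = L n (a n))
    (ha : Tendsto (fun n : ℕ => Real.log ‖a n‖ / n) atTop (𝓝 c))
    (hb : Tendsto (fun n : ℕ => Real.log ‖b n‖ / n) atTop (𝓝 d))
    (h : ∃ᶠ n in atTop, ‖L n‖ ≤ K ∧ ‖L' n‖ ≤ K) : c = d := by
  have hba : ∀ n, a n = L' n (b n) := fun n => by
    simpa [hab n] using (DFunLike.congr_fun (hL n) (a n)).symm
  have hb0 : ∀ n, b n ≠ 0 := fun n hn => ha0 n (by rw [hba n, hn, map_zero])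
  refine le_antisymm ?_ ?_
  · refine growthRate_le_of_frequently (K := K) hb0 ha0 hb ha (h.mono fun n hn => ?_)
    rw [hba n]
    exact (L' n).le_of_opNorm_le hn.2 _
  · refine growthRate_le_of_frequently (K := K) ha0 hb0 ha hb (h.mono fun n hn => ?_)
    rw [hab n]
    exact (L n).le_of_opNorm_le hn.1 _

/-- Along almost every orbit of a conservative system, two measurable real functions return
infinitely often below a common bound. -/
theorem ae_exists_frequently_le {M : Type*} [MeasurableSpace M] {μ : Measure M} {g : M → M}
    (hg : Conservative g μ) {φ ψ : M → ℝ} (hφ : Measurable φ) (hψ : Measurable ψ) :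
    ∀ᵐ x ∂μ, ∃ K : ℝ, ∃ᶠ n in atTop, φ (g^[n] x) ≤ K ∧ ψ (g^[n] x) ≤ K := by
  have hrec : ∀ k : ℕ, ∀ᵐ x ∂μ, x ∈ {y | φ y ≤ k ∧ ψ y ≤ k} →
      ∃ᶠ n in atTop, g^[n] x ∈ {y | φ y ≤ k ∧ ψ y ≤ k} := fun k =>
    hg.ae_mem_imp_frequently_image_mem
      ((measurableSet_le hφ measurable_const).inter
        (measurableSet_le hψ measurable_const)).nullMeasurableSet
  filter_upwards [ae_all_iff.2 hrec] with x hx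
  obtain ⟨k, hk⟩ := exists_nat_ge (max (φ x) (ψ x))
  exact ⟨k, hx k ⟨(le_max_left _ _).trans hk, (le_max_right _ _).trans hk⟩⟩

/-- A property that holds almost everywhere holds along almost every whole orbit. -/
theorem ae_forall_iterate {M : Type*} [MeasurableSpace M] {μ : Measure M} {g : M → M}
    (hg : Measure.QuasiMeasurePreserving g μ μ) {p : M → Prop} (hp : ∀ᵐ x ∂μ, p x) :
    ∀ᵐ x ∂μ, ∀ n : ℕ, p (g^[n] x) :=
  ae_all_iff.2 fun n => (hg.iterate n).ae hp

theorem ne_zero_of_comp_eq_one {E : Type*} [NormedAddCommGroup E] [NormedSpace ℝ E]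
    {L L' : E →L[ℝ] E} (h : L'.comp L = 1) {u : E} (hu : u ≠ 0) : L u ≠ 0 := fun h0 =>
  hu (by simpa [h0] using (DFunLike.congr_fun h u).symm)

section Cocycle

variable {M : Type*} {N : ℕ} {f finv : M → M} {A A' B B' C : M → (Euc N →L[ℝ] Euc N)}

theorem coc_ne_zero (hA : ∀ x, (A' x).comp (A x) = 1) (x : M) {u : Euc N} (hu : u ≠ 0) (n : ℕ) :
    coc f A n x u ≠ 0 := by
  induction n with
  | zero => exact hu
  | succ n ih => exact ne_zero_of_comp_eq_one (hA _) ih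

theorem cocNeg_ne_zero (hA : ∀ x, (A x).comp (A' x) = 1) (x : M) {u : Euc N} (hu : u ≠ 0)
    (n : ℕ) : cocNeg finv A' n x u ≠ 0 := by
  induction n generalizing x u with
  | zero => exact hu
  | succ n ih => exact ih _ (ne_zero_of_comp_eq_one (hA _) hu)

theorem coc_conj {x : M}
    (h : ∀ n : ℕ, (B (f^[n] x)).comp (C (f^[n] x)) = (C (f (f^[n] x))).comp (A (f^[n] x)))
    (u : Euc N) (n : ℕ) : coc f B n x (C x u) = C (f^[n] x) (coc f A n x u) := by
  induction n with
  | zero => rfl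
  | succ n ih =>
    rw [Function.iterate_succ_apply']
    change B (f^[n] x) (coc f B n x (C x u)) = _
    rw [ih]
    exact DFunLike.congr_fun (h n) (coc f A n x u)

theorem cocNeg_conj {x : M}
    (h : ∀ n : ℕ, (B' (finv (finv^[n] x))).comp (C (finv^[n] x)) =
      (C (finv (finv^[n] x))).comp (A' (finv (finv^[n] x))))
    (u : Euc N) (n : ℕ) :
    cocNeg finv B' n x (C x u) = C (finv^[n] x) (cocNeg finv A' n x u) := by
  induction n generalizing x u with
  | zero => rfl
  | succ n ih =>
    have h0 : B' (finv x) (C x u) = C (finv x) (A' (finv x) u) := DFunLike.congr_fun (h 0) u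
    change cocNeg finv B' n (finv x) (B' (finv x) (C x u)) = _
    rw [h0]
    exact ih (fun n => h (n + 1)) _

/-- Conjugacy of the generators passes to their inverses. -/
theorem conj_inverse {E : Type*} [NormedAddCommGroup E] [NormedSpace ℝ E]
    {S S' T T' P Q : E →L[ℝ] E} (hS : S.comp S' = 1) (hT : T'.comp T = 1)
    (h : T.comp P = Q.comp S) : T'.comp Q = P.comp S' := by
  calc T'.comp Q = (T'.comp Q).comp (S.comp S') := by rw [hS]; rfl
    _ = T'.comp ((Q.comp S).comp S') := rfl
    _ = (T'.comp T).comp (P.comp S') := by rw [← h]; rfl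
    _ = P.comp S' := by rw [hT]; rfl

end Cocycle

theorem stmt_9
    {M : Type*} [MetricSpace M] [CompactSpace M]
    [MeasurableSpace M] [BorelSpace M]
    -- f is a homeomorphism of M, with inverse finv
    (f finv : M → M) (hf : Continuous f) (hfinv : Continuous finv)
    (hlinv : ∀ x, finv (f x) = x) (hrinv : ∀ x, f (finv x) = x)
    {N : ℕ}
    -- 𝒜 and ℬ : continuous GL(N,ℝ)-valued cocycles (generators and their inverses)
    (A A' B B' : M → (Euc N →L[ℝ] Euc N))
    (hA : Continuous A) (hA' : Continuous A') (hB : Continuous B) (hB' : Continuous B')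
    (hAinv : ∀ x, (A x).comp (A' x) = 1 ∧ (A' x).comp (A x) = 1)
    (hBinv : ∀ x, (B x).comp (B' x) = 1 ∧ (B' x).comp (B x) = 1)
    -- μ : ergodic f-invariant Borel probability measure
    (μ : Measure M) [IsProbabilityMeasure μ] (herg : Ergodic f μ)
    -- 𝒞 : μ-measurable conjugacy taking 𝒜 to ℬ : ℬ_x = 𝒞(fx) 𝒜_x 𝒞(x)⁻¹ μ-a.e.
    (C C' : M → (Euc N →L[ℝ] Euc N)) (hC : Measurable C) (hC' : Measurable C')
    (hCinv : ∀ᵐ x ∂μ, (C x).comp (C' x) = 1 ∧ (C' x).comp (C x) = 1)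
    (hconj : ∀ᵐ x ∂μ, (B x).comp (C x) = (C (f x)).comp (A x))
    -- existence a.e. of forward and backward exponents for all nonzero vectors
    (hexist : ∀ᵐ x ∂μ, ∀ u : Euc N, u ≠ 0 →
      (∃ c, FwdExp f A x u c) ∧ (∃ c, BwdExp finv A' x u c) ∧
      (∃ c, FwdExp f B x u c) ∧ (∃ c, BwdExp finv B' x u c)) :
    ∀ᵐ x ∂μ, ∀ u : Euc N, u ≠ 0 → ∀ c : ℝ,
      (FwdExp f A x u c → FwdExp f B x (C x u) c) ∧
      (BwdExp finv A' x u c → BwdExp finv B' x (C x u) c) := by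
  have hmp : MeasurePreserving f μ μ := herg.toMeasurePreserving
  have hmp' : MeasurePreserving finv μ μ :=
    hmp.symm (⟨⟨f, finv, hlinv, hrinv⟩, hf.measurable, hfinv.measurable⟩ : M ≃ᵐ M)
  filter_upwards [hexist, hCinv,
    ae_forall_iterate hmp.quasiMeasurePreserving hCinv,
    ae_forall_iterate hmp'.quasiMeasurePreserving hCinv,
    ae_forall_iterate hmp.quasiMeasurePreserving hconj,
    ae_forall_iterate hmp'.quasiMeasurePreserving (hmp'.quasiMeasurePreserving.ae hconj),
    ae_exists_frequently_le hmp.conservative hC.norm hC'.norm,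
    ae_exists_frequently_le hmp'.conservative hC.norm hC'.norm]
    with x hex hCx hCf hCb hconjf hconjb ⟨K, hK⟩ ⟨K', hK'⟩ u hu c
  obtain ⟨-, -, ⟨d, hd⟩, ⟨e, he⟩⟩ := hex (C x u) (ne_zero_of_comp_eq_one hCx.2 hu)
  constructor
  · intro hc
    have hcd : c = d := growthRate_eq_of_intertwined
      (fun n => coc_ne_zero (fun y => (hAinv y).2) x hu n) (fun n => (hCf n).2)
      (coc_conj hconjf u) hc hd hK
    rwa [hcd]
  · intro hc
    have hback : ∀ n : ℕ, (B' (finv (finv^[n] x))).comp (C (finv^[n] x)) =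
        (C (finv (finv^[n] x))).comp (A' (finv (finv^[n] x))) := fun n =>
      conj_inverse (hAinv _).1 (hBinv _).2 (by simpa only [hrinv] using hconjb n)
    have hce : -c = -e := growthRate_eq_of_intertwined
      (fun n => cocNeg_ne_zero (fun y => (hAinv y).1) x hu n) (fun n => (hCb n).2)
      (cocNeg_conj hback u) (by simpa using hc.neg) (by simpa using he.neg) hK'
    rwa [neg_inj.1 hce]

end
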